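/- If b ≥ 2 is odd and p, q are primes with q - p = Δ > 0 and s_b(p·q) = Δ, then a contradiction follows; that is, there are no base-b SanD primes for odd bases b ≥ 3. -/

import Mathlib

theorem no_sand_primes_odd_base (b p Δ : ℕ) (hb : 2 ≤ b) (hbodd : Odd b)
    (hp : Nat.Prime p) (hq : Nat.Prime (p + Δ)) (hΔ : 0 < Δ)
    (h : (Nat.digits b (p * (p + Δ))).sum = Δ) : False := by
  have h2 := Nat.modEq_digits_sum 2 b (Nat.odd_iff.mp hbodd) (p * (p + Δ))
  rw [h] at h2
  unfold Nat.ModEq at h2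
  have hp2 := hp.two_le
  rcases hq.eq_two_or_odd with hq2 | hq2
  · omega
  · rw [Nat.mul_mod, hq2] at h2
    rcases Nat.mod_two_eq_zero_or_one p with h0 | h0 <;> rw [h0] at h2 <;> omega
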